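/- Let A and B be commutative complex Banach algebras and let T : A → B be a bounded (continuous) ℂ-linear operator such that T(e) is an idempotent of B whenever e is an idempotent of A. Then T is multiplicative on the closed linear span of the idempotents of A: for any x, y in the closure of the ℂ-linear span of the set of idempotents of A, T(x·y) = T(x)·T(y). -/

import Mathlib

section

variable {A B F : Type*} [NonUnitalCommRing A] [NonUnitalCommRing B]
  [FunLike F A B] [AddMonoidHomClass F A B]

/-- An additive map preserving idempotents preserves orthogonality of idempotents, provided the
codomain is additively torsion-free. -/
theorem map_mul_map_eq_zero_of_isIdempotentElem [IsAddTorsionFree B] {T : F}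
    (hT : ∀ e : A, IsIdempotentElem e → IsIdempotentElem (T e)) {e f : A}
    (he : IsIdempotentElem e) (hf : IsIdempotentElem f) (hef : e * f = 0) :
    T e * T f = 0 := by
  have h : IsIdempotentElem (T (e + f)) := hT _ <| by
    simp only [IsIdempotentElem, add_mul, mul_add, he.eq, hf.eq, hef, mul_comm f e, add_zero,
      zero_add]
  simp only [map_add, IsIdempotentElem, add_mul, mul_add, (hT e he).eq, (hT f hf).eq,
    mul_comm (T f) (T e)] at h
  refine self_eq_neg.mp (eq_neg_of_add_eq_zero_left ?_)
  have h' := sub_eq_zero.mpr h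
  rw [← h']
  abel

/-- An additive map preserving idempotents is multiplicative on idempotents, provided the
codomain is additively torsion-free. -/
theorem map_mul_of_isIdempotentElem [IsAddTorsionFree B] {T : F}
    (hT : ∀ e : A, IsIdempotentElem e → IsIdempotentElem (T e)) {e f : A}
    (he : IsIdempotentElem e) (hf : IsIdempotentElem f) :
    T (e * f) = T e * T f := by
  have hef : IsIdempotentElem (e * f) := he.mul hf
  have left : e * (e * f) = e * f := by rw [← mul_assoc, he.eq]
  have right : f * (e * f) = e * f := by rw [mul_left_comm, hf.eq]
  have ha : IsIdempotentElem (e - e * f) := by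
    simp [IsIdempotentElem, sub_mul, mul_sub, he.eq, hef.eq, left, mul_comm (e * f) e]
  have hb : IsIdempotentElem (f - e * f) := by
    simp [IsIdempotentElem, sub_mul, mul_sub, hf.eq, hef.eq, right, mul_comm (e * f) f]
  have hab := map_mul_map_eq_zero_of_isIdempotentElem hT ha hb
    (by simp [sub_mul, mul_sub, hef.eq, left, right, mul_comm (e * f) f])
  have hac := map_mul_map_eq_zero_of_isIdempotentElem hT ha hef
    (by simp [sub_mul, hef.eq, left])
  have hcb := map_mul_map_eq_zero_of_isIdempotentElem hT hef hb
    (by simp [mul_sub, hef.eq, right, mul_comm (e * f) f])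
  calc T (e * f) = T (e * f) * T (e * f) := (hT _ hef).eq.symm
    _ = (T (e - e * f) + T (e * f)) * (T (f - e * f) + T (e * f)) := by
      simp only [add_mul, mul_add, hab, hac, hcb, zero_add]
    _ = T e * T f := by simp only [← map_add, sub_add_cancel]

end

/-- A linear map that is multiplicative on a set is multiplicative on its linear span. -/
theorem LinearMap.map_mul_of_mem_span {R A B : Type*} [CommSemiring R]
    [NonUnitalNonAssocSemiring A] [Module R A] [IsScalarTower R A A] [SMulCommClass R A A]
    [NonUnitalNonAssocSemiring B] [Module R B] [IsScalarTower R B B] [SMulCommClass R B B]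
    {T : A →ₗ[R] B} {s : Set A} (h : ∀ x ∈ s, ∀ y ∈ s, T (x * y) = T x * T y) {x y : A}
    (hx : x ∈ Submodule.span R s) (hy : y ∈ Submodule.span R s) :
    T (x * y) = T x * T y := by
  induction hx, hy using Submodule.span_induction₂ with
  | mem_mem x y hx hy => exact h x hx y hy
  | zero_left y hy => simp
  | zero_right x hx => simp
  | add_left x y z hx hy hz h₁ h₂ => simp [add_mul, h₁, h₂]
  | add_right x y z hx hy hz h₁ h₂ => simp [mul_add, h₁, h₂]
  | smul_left r x y hx hy h => simp [smul_mul_assoc, h]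
  | smul_right r x y hx hy h => simp [mul_smul_comm, h]

/-- A continuous map that is multiplicative on a set is multiplicative on its closure. -/
theorem Continuous.map_mul_of_mem_closure {A B : Type*} [TopologicalSpace A] [Mul A]
    [ContinuousMul A] [TopologicalSpace B] [T2Space B] [Mul B] [ContinuousMul B] {f : A → B}
    (hf : Continuous f) {s : Set A} (h : ∀ x ∈ s, ∀ y ∈ s, f (x * y) = f x * f y) {x y : A}
    (hx : x ∈ closure s) (hy : y ∈ closure s) : f (x * y) = f x * f y := by
  have hxy : (x, y) ∈ closure (s ×ˢ s) := by
    rw [closure_prod_eq]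
    exact ⟨hx, hy⟩
  have hs : Set.EqOn (fun p : A × A => f (p.1 * p.2)) (fun p => f p.1 * f p.2) (s ×ˢ s) :=
    fun p hp => h p.1 hp.1 p.2 hp.2
  exact hs.closure (by fun_prop) (by fun_prop) hxy

/-- A bounded ℂ-linear operator between commutative complex Banach
algebras sending idempotents to idempotents is multiplicative on the closed
linear span of the idempotents. -/
theorem bounded_idempotent_preserver_multiplicative_on_closed_span
    {A B : Type*} [NormedCommRing A] [NormedAlgebra ℂ A] [CompleteSpace A]
    [NormedCommRing B] [NormedAlgebra ℂ B] [CompleteSpace B]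
    (T : A →L[ℂ] B)
    (hT : ∀ e : A, IsIdempotentElem e → IsIdempotentElem (T e)) :
    ∀ x y : A,
      x ∈ closure (Submodule.span ℂ {e : A | IsIdempotentElem e} : Set A) →
      y ∈ closure (Submodule.span ℂ {e : A | IsIdempotentElem e} : Set A) →
      T (x * y) = T x * T y := by
  have : IsAddTorsionFree B := .of_isTorsionFree ℂ B
  intro x y hx hy
  exact T.continuous.map_mul_of_mem_closure
    (fun u hu v hv => LinearMap.map_mul_of_mem_span (T := T.toLinearMap)
      (fun e he f hf => map_mul_of_isIdempotentElem hT he hf) hu hv) hx hy
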